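/- Let K be a field, n ≥ 2 and m ≥ 2 integers, and a : S_m → K a function on the symmetric group S_m. Let b = ∑ a_σ over those σ ∈ S_m for which σ⁻¹(1) < σ⁻¹(2), and c = ∑ a_σ over those σ ∈ S_m for which σ⁻¹(2) < σ⁻¹(1). If (b, c) ≠ (0, 0), then the set {∑_{σ∈S_m} a_σ A_{σ(1)} A_{σ(2)} ⋯ A_{σ(m)} | A_1,…,A_m ∈ M_n(K)} contains every matrix of trace 0 in M_n(K). -/

import Mathlib

theorem List.prod_ofFn_eq_of_forall_ne {M : Type*} [Monoid M] {m : ℕ} (B : Fin m → M) (p : Fin m)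
    (h : ∀ i, i ≠ p → B i = 1) : (List.ofFn B).prod = B p := by
  induction m with
  | zero => exact p.elim0
  | succ m ih =>
    rw [List.ofFn_succ, List.prod_cons]
    cases p using Fin.cases with
    | zero =>
      have : (List.ofFn fun i : Fin m => B i.succ) = List.replicate m 1 := by
        rw [← List.ofFn_const]
        congr 1
        funext i
        exact h _ (Fin.succ_ne_zero i)
      rw [this, List.prod_replicate, one_pow, mul_one]
    | succ p =>
      rw [h 0 (Fin.succ_ne_zero p).symm, one_mul]
      exact ih (fun i => B i.succ) p fun i hi => h _ fun h' => hi (Fin.succ_injective _ h')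

theorem List.prod_ofFn_eq_mul {M : Type*} [Monoid M] {m : ℕ} (B : Fin m → M) {p q : Fin m}
    (hpq : p < q) (h : ∀ i, i ≠ p → i ≠ q → B i = 1) : (List.ofFn B).prod = B p * B q := by
  induction m with
  | zero => exact p.elim0
  | succ m ih =>
    rw [List.ofFn_succ, List.prod_cons]
    cases q using Fin.cases with
    | zero => exact absurd hpq (Fin.not_lt_zero p)
    | succ q =>
      cases p using Fin.cases with
      | zero =>
        congr 1
        exact List.prod_ofFn_eq_of_forall_ne (fun i => B i.succ) q fun i hi =>
          h _ (Fin.succ_ne_zero i) fun h' => hi (Fin.succ_injective _ h')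
      | succ p =>
        rw [h 0 (Fin.succ_ne_zero p).symm (Fin.succ_ne_zero q).symm, one_mul]
        exact ih (fun i => B i.succ) (Fin.succ_lt_succ_iff.mp hpq) fun i hp hq =>
          h _ (fun h' => hp (Fin.succ_injective _ h')) fun h' => hq (Fin.succ_injective _ h')

/-- A multilinear polynomial evaluated at `1` in all but two variables. -/
theorem sum_smul_prod_ofFn_eq {K R : Type*} [Field K] [Ring R] [Algebra K R] {m : ℕ}
    (a : Equiv.Perm (Fin m) → K) {p q : Fin m} (hpq : p ≠ q) (X Y : R) :
    ∑ σ : Equiv.Perm (Fin m), a σ •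
        (List.ofFn fun i => if σ i = p then X else if σ i = q then Y else 1).prod =
      (∑ σ : Equiv.Perm (Fin m), if σ⁻¹ p < σ⁻¹ q then a σ else 0) • (X * Y) +
        (∑ σ : Equiv.Perm (Fin m), if σ⁻¹ q < σ⁻¹ p then a σ else 0) • (Y * X) := by
  rw [Finset.sum_smul, Finset.sum_smul, ← Finset.sum_add_distrib]
  refine Finset.sum_congr rfl fun σ _ => ?_
  have hp : ∀ i, i ≠ σ⁻¹ p → σ i ≠ p := fun i hi h => hi (by rw [← h]; simp)
  have hq : ∀ i, i ≠ σ⁻¹ q → σ i ≠ q := fun i hi h => hi (by rw [← h]; simp)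
  have hne : σ⁻¹ p ≠ σ⁻¹ q := fun h => hpq (σ⁻¹.injective h)
  rcases lt_or_gt_of_ne hne with h | h
  · rw [List.prod_ofFn_eq_mul _ h fun i h1 h2 => by simp [hp i h1, hq i h2]]
    rw [if_pos h, if_neg h.not_gt]
    simp [hpq.symm]
  · rw [List.prod_ofFn_eq_mul _ h fun i h1 h2 => by simp [hp i h2, hq i h1]]
    rw [if_neg h.not_gt, if_pos h]
    simp [hpq.symm]

/-- If `v` and `f v` are linearly independent, then they extend to a family of any size up to the
dimension in which `f` is in upper Hessenberg form. -/
theorem exists_linearIndependent_hessenberg {K V : Type*} [Field K] [AddCommGroup V] [Module K V]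
    (f : V →ₗ[K] V) {v : V} (hv : LinearIndependent K ![v, f v]) (k : ℕ)
    (hk : k + 2 ≤ Module.finrank K V) :
    ∃ b : Fin (k + 2) → V, LinearIndependent K b ∧ b 0 = v ∧ b 1 = f v ∧
      ∀ i : Fin (k + 2), (i : ℕ) + 1 < k + 2 →
        f (b i) ∈ Submodule.span K (b '' {j | (j : ℕ) ≤ i + 1}) := by
  induction k with
  | zero =>
    refine ⟨![v, f v], hv, rfl, rfl, fun i hi => ?_⟩
    have : i = 0 := by ext; simp; omega
    subst this
    exact Submodule.subset_span ⟨1, by simp, rfl⟩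
  | succ k ih =>
    obtain ⟨b, hb, h0, h1, hf⟩ := ih (by omega)
    obtain ⟨w, hw, hfw⟩ : ∃ w, w ∉ Submodule.span K (Set.range b) ∧
        f (b (Fin.last _)) ∈ Submodule.span K (Set.range b ∪ {w}) := by
      by_cases h : f (b (Fin.last _)) ∈ Submodule.span K (Set.range b)
      · obtain ⟨w, hw⟩ : ∃ w, w ∉ Submodule.span K (Set.range b) := by
          by_contra! hall
          have htop : Submodule.span K (Set.range b) = ⊤ := Submodule.eq_top_iff'.mpr hall
          have := finrank_span_eq_card hb
          rw [htop, finrank_top, Fintype.card_fin] at this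
          omega
        exact ⟨w, hw, Submodule.span_mono Set.subset_union_left h⟩
      · exact ⟨_, h, Submodule.subset_span (by simp)⟩
    refine ⟨Fin.snoc b w, linearIndependent_finSnoc.mpr ⟨hb, hw⟩, ?_, ?_, ?_⟩
    · rw [← h0]; exact Fin.snoc_castSucc (α := fun _ => V) w b 0
    · rw [← h1]; exact Fin.snoc_castSucc (α := fun _ => V) w b 1
    · intro i hi
      cases i using Fin.lastCases with
      | last => simp at hi
      | cast i =>
        rw [Fin.snoc_castSucc]
        by_cases hlt : (i : ℕ) + 1 < k + 2
        · refine Submodule.span_mono ?_ (hf i hlt)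
          rintro _ ⟨j, hj, rfl⟩
          exact ⟨j.castSucc, by simpa using hj, by simp⟩
        · have : i = Fin.last _ := by ext; simp; omega
          subst this
          refine Submodule.span_mono ?_ hfw
          rintro _ (⟨j, rfl⟩ | rfl)
          · exact ⟨j.castSucc, by simp, by simp⟩
          · exact ⟨Fin.last _, by simp, by simp⟩

open Finset in
theorem sum_diag_eq_add_sum_diag {K : Type*} [AddCommMonoid K] {n : ℕ} (m : ℕ → ℕ → K)
    (hrow : ∀ i j, n ≤ i → m i j = 0) (i j : ℕ) :
    ∑ t ∈ range n, m (i + t) (j + t) =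
      m i j + ∑ t ∈ range n, m (i + 1 + t) (j + 1 + t) := by
  have h := sum_range_succ' (fun t => m (i + t) (j + t)) n
  rw [sum_range_succ, hrow (i + n) _ (by omega), add_zero] at h
  rw [h, add_comm]
  congr 1
  exact sum_congr rfl fun t _ => by congr 1 <;> omega

open Finset Matrix in
/-- An upper Hessenberg matrix whose diagonal and subdiagonal both sum to zero is a commutator. -/
theorem exists_commutator_of_hessenberg_of_sum_subdiag_eq_zero {K : Type*} [Field K] {n : ℕ}
    (m : ℕ → ℕ → K) (hrow : ∀ i j, n ≤ i → m i j = 0)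
    (hess : ∀ i j, j + 1 < i → m i j = 0) (hdiag : ∑ t ∈ range n, m t t = 0)
    (hsub : ∑ t ∈ range n, m (t + 1) t = 0) :
    ∃ X Y : Matrix (Fin n) (Fin n) K, of (fun i j : Fin n => m i j) = X * Y - Y * X := by
  set s : ℕ → ℕ → K := fun i j => ∑ t ∈ range n, m (i + t) (j + t) with hs
  have hs_succ : ∀ i j, s i j = m i j + s (i + 1) (j + 1) := sum_diag_eq_add_sum_diag m hrow
  have hs_row : ∀ i j, n ≤ i → s i j = 0 := fun i j hi =>
    sum_eq_zero fun t _ => hrow _ _ (by omega)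
  have hs_zero : ∀ i, s i 0 = 0 := by
    intro i
    rcases i with _ | _ | i
    · simpa [hs] using hdiag
    · simpa [hs, add_comm] using hsub
    · exact sum_eq_zero fun t _ => hess _ _ (by omega)
  refine ⟨of fun i l : Fin n => if (l : ℕ) = i + 1 then 1 else 0,
    of fun i j : Fin n => -s i (j + 1), ?_⟩
  ext i j
  have h1 : ∑ l : Fin n, (if (l : ℕ) = i + 1 then (1 : K) else 0) * -s l (j + 1) =
      -s (i + 1) (j + 1) := by
    rw [Fin.sum_univ_eq_sum_range (fun l => (if l = (i : ℕ) + 1 then (1 : K) else 0) *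
      -s l (j + 1))]
    simp only [ite_mul, one_mul, zero_mul, sum_ite_eq', mem_range]
    split_ifs with h
    · rfl
    · rw [hs_row _ _ (by omega), neg_zero]
  have h2 : ∑ l : Fin n, -s i (l + 1) * (if (j : ℕ) = l + 1 then (1 : K) else 0) = -s i j := by
    rw [Fin.sum_univ_eq_sum_range (fun l => -s i (l + 1) *
      (if (j : ℕ) = l + 1 then (1 : K) else 0))]
    obtain ⟨j, hj⟩ := j
    cases j with
    | zero => simp [hs_zero]
    | succ j =>
      simp only [add_left_inj, mul_ite, mul_one, mul_zero, sum_ite_eq, mem_range]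
      rw [if_pos (by omega)]
  simp only [Matrix.sub_apply, Matrix.mul_apply, of_apply, h1, h2]
  rw [hs_succ i j]
  ring

open Finset Matrix in
/-- An upper Hessenberg matrix of trace zero whose top left entry is zero and whose subdiagonal,
without its first entry, sums to zero is a commutator. -/
theorem exists_commutator_of_hessenberg_of_sum_tail_subdiag_eq_zero {K : Type*} [Field K] {n : ℕ}
    (m : ℕ → ℕ → K) (hrow : ∀ i j, n ≤ i → m i j = 0)
    (hess : ∀ i j, j + 1 < i → m i j = 0) (hzero : m 0 0 = 0)
    (hdiag : ∑ t ∈ range n, m (t + 1) (t + 1) = 0)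
    (hsub : ∑ t ∈ range n, m (t + 2) (t + 1) = 0) :
    ∃ X Y : Matrix (Fin n) (Fin n) K, of (fun i j : Fin n => m i j) = X * Y - Y * X := by
  set s : ℕ → ℕ → K := fun i j => ∑ t ∈ range n, m (i + t) (j + t) with hs
  have hs_succ : ∀ i j, s i j = m i j + s (i + 1) (j + 1) := sum_diag_eq_add_sum_diag m hrow
  have hs_row : ∀ i j, n ≤ i → s i j = 0 := fun i j hi =>
    sum_eq_zero fun t _ => hrow _ _ (by omega)
  have hs_one : ∀ i, s (i + 1) 1 = 0 := by
    intro i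
    rcases i with _ | _ | i
    · simpa [hs, add_comm] using hdiag
    · simpa [hs, add_comm] using hsub
    · exact sum_eq_zero fun t _ => hess _ _ (by omega)
  set y : ℕ → ℕ → K := fun i j =>
    if i = 0 then ∑ l ∈ range j, m 0 (l + 1) else if j = 0 then -m i 0 else -s i (j + 1) with hy
  have hy_row : ∀ i j, n ≤ i → i ≠ 0 → y i j = 0 := by
    intro i j hi hi0
    simp [hy, hi0, hrow i 0 hi, hs_row i _ hi]
  set c : ℕ → ℕ := fun i => if i = 0 then 0 else i + 1 with hc
  refine ⟨of fun i l : Fin n => if (l : ℕ) = c i then 1 else 0, of fun i j : Fin n => y i j, ?_⟩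
  ext i j
  have hn : 0 < n := i.pos
  have h1 : ∑ l : Fin n, (if (l : ℕ) = c i then (1 : K) else 0) * y l j = y (c i) j := by
    rw [Fin.sum_univ_eq_sum_range (fun l => (if l = c i then (1 : K) else 0) * y l j)]
    simp only [ite_mul, one_mul, zero_mul, sum_ite_eq', mem_range]
    split_ifs with h
    · rfl
    · rw [hy_row _ _ (by omega) (by omega)]
  have h2 : ∑ l : Fin n, y i l * (if (j : ℕ) = c l then (1 : K) else 0) =
      if (j : ℕ) = 0 then y i 0 else if (j : ℕ) = 1 then 0 else y i (j - 1) := by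
    rw [Fin.sum_univ_eq_sum_range (fun l => y i l * (if (j : ℕ) = c l then (1 : K) else 0))]
    obtain ⟨j, hj⟩ := j
    rcases j with _ | _ | j
    · rw [sum_eq_single_of_mem 0 (by simpa using hn)]
      · simp [hc]
      · intro l _ hl
        simp [hc, hl]
    · rw [sum_eq_zero]
      · simp
      · intro l _
        by_cases hl : l = 0 <;> simp [hc, hl]
    · rw [sum_eq_single_of_mem (j + 1) (by simp; omega)]
      · simp [hc]
      · intro l _ hl
        by_cases hl0 : l = 0
        · simp [hc, hl0]
        · simp only [hc, hl0, if_false]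
          rw [if_neg (by omega), mul_zero]
  simp only [Matrix.sub_apply, Matrix.mul_apply, of_apply, h1, h2]
  clear h1 h2
  obtain ⟨i, hi⟩ := i
  obtain ⟨j, hj⟩ := j
  rcases i with _ | i
  · rcases j with _ | _ | j
    · simp [hc, hy, hzero]
    · simp [hc, hy]
    · simp [hc, hy, sum_range_succ _ (j + 1)]
  · rcases j with _ | _ | j
    · simp [hc, hy, hess (i + 1 + 1) 0 (by omega)]
    · have h := hs_succ (i + 1) 1
      rw [hs_one] at h
      simp only [hc, hy]
      simp
      linear_combination -h
    · have h := hs_succ (i + 1) (j + 2)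
      simp only [hc, hy]
      simp
      linear_combination -h

open Finset Matrix in
/-- An upper Hessenberg matrix of trace zero whose top left entry is zero and whose first
subdiagonal entry is not zero is a commutator. -/
theorem exists_commutator_of_hessenberg {K : Type*} [Field K] {n : ℕ}
    (m : ℕ → ℕ → K) (hrow : ∀ i j, n ≤ i → m i j = 0) (hcol : ∀ i j, n ≤ j → m i j = 0)
    (hess : ∀ i j, j + 1 < i → m i j = 0) (hzero : m 0 0 = 0) (hone : m 1 0 ≠ 0)
    (hdiag : ∑ t ∈ range n, m t t = 0) :
    ∃ X Y : Matrix (Fin n) (Fin n) K, of (fun i j : Fin n => m i j) = X * Y - Y * X := by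
  by_cases hsub : ∑ t ∈ range n, m (t + 2) (t + 1) = 0
  · refine exists_commutator_of_hessenberg_of_sum_tail_subdiag_eq_zero m hrow hess hzero ?_
      hsub
    have := sum_range_succ' (fun t => m t t) n
    rw [sum_range_succ, hrow n n le_rfl, hdiag, hzero] at this
    simpa using this.symm
  · set r := ∑ t ∈ range n, m (t + 2) (t + 1) with hr
    set d : ℕ → K := fun i => if i = 0 then -r / m 1 0 else 1 with hd
    have hd0 : ∀ i, d i ≠ 0 := by
      intro i
      by_cases hi : i = 0 <;> simp [hd, hi, hone, hsub]
    obtain ⟨X, Y, h⟩ := exists_commutator_of_hessenberg_of_sum_subdiag_eq_zero (n := n)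
      (fun i j => (d i)⁻¹ * m i j * d j) (fun i j hi => by simp [hrow i j hi])
      (fun i j hij => by simp [hess i j hij])
      (by
        rw [← hdiag]
        refine sum_congr rfl fun t _ => ?_
        have := hd0 t
        field_simp)
      (by
        have h1 := sum_range_succ' (fun t => (d (t + 1))⁻¹ * m (t + 1) t * d t) n
        rw [sum_range_succ, hcol (n + 1) n le_rfl] at h1
        simp only [mul_zero, zero_mul, add_zero] at h1
        rw [h1]
        simp only [hd]
        simp [add_assoc, ← hr]
        field_simp
        ring)
    set D : Matrix (Fin n) (Fin n) K := diagonal fun i => d i with hD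
    set E : Matrix (Fin n) (Fin n) K := diagonal fun i => (d i)⁻¹ with hE
    have hED : E * D = 1 := by
      rw [hE, hD, diagonal_mul_diagonal, ← diagonal_one]
      congr 1
      funext i
      exact inv_mul_cancel₀ (hd0 i)
    refine ⟨D * X * E, D * Y * E, ?_⟩
    have hconj : of (fun i j : Fin n => m i j) =
        D * of (fun i j : Fin n => (d i)⁻¹ * m i j * d j) * E := by
      ext i j
      rw [hD, hE, mul_diagonal, diagonal_mul, of_apply, of_apply]
      have := hd0 i
      have := hd0 j
      field_simp
    have hXY : ∀ P Q : Matrix (Fin n) (Fin n) K, D * P * E * (D * Q * E) = D * (P * Q) * E := by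
      intro P Q
      calc D * P * E * (D * Q * E) = D * P * (E * D) * Q * E := by simp only [Matrix.mul_assoc]
        _ = D * (P * Q) * E := by rw [hED]; simp only [Matrix.mul_one, Matrix.mul_assoc]
    rw [hconj, h, hXY, hXY, Matrix.mul_sub, Matrix.sub_mul]

open Finset Matrix in
/-- The **Albert–Muckenhoupt theorem**: a square matrix of trace zero over a field is a
commutator. -/
theorem Matrix.exists_eq_commutator_of_trace_eq_zero {K : Type*} [Field K] {n : ℕ}
    (M : Matrix (Fin n) (Fin n) K) (hM : M.trace = 0) :
    ∃ X Y : Matrix (Fin n) (Fin n) K, M = X * Y - Y * X := by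
  have hext : ∀ A : Matrix (Fin n) (Fin n) K, ∃ m : ℕ → ℕ → K, A = of (fun i j : Fin n => m i j) ∧
      (∀ i j, n ≤ i → m i j = 0) ∧ (∀ i j, n ≤ j → m i j = 0) := by
    intro A
    refine ⟨fun i j => if h : i < n ∧ j < n then A ⟨i, h.1⟩ ⟨j, h.2⟩ else 0, ?_, ?_, ?_⟩
    · ext i j
      simp
    · intro i j h
      exact dif_neg (by omega)
    · intro i j h
      exact dif_neg (by omega)
  have htr : ∀ m : ℕ → ℕ → K, (of (fun i j : Fin n => m i j)).trace = ∑ t ∈ range n, m t t :=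
    fun m => Fin.sum_univ_eq_sum_range (fun t => m t t) n
  by_cases hscalar : ∀ v, ¬ LinearIndependent K ![v, M.toLin' v]
  · obtain ⟨a, ha⟩ := (M.toLin').exists_eq_smul_id_of_forall_notLinearIndependent hscalar
    have hMa : M = a • 1 := by
      rw [← LinearMap.toMatrix'_toLin' M, ha, map_smul, LinearMap.toMatrix'_one]
    obtain ⟨m, hm, hrow, hcol⟩ := hext M
    have hne : ∀ i j, j < i → m i j = 0 := by
      intro i j hij
      by_cases hi : i < n
      · have h := congrFun (congrFun (hm.symm.trans hMa) ⟨i, hi⟩) ⟨j, by omega⟩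
        simpa [Matrix.one_apply, hij.ne'] using h
      · exact hrow i j (by omega)
    rw [hm, htr] at hM
    rw [hm]
    exact exists_commutator_of_hessenberg_of_sum_subdiag_eq_zero m hrow
      (fun i j hij => hne i j (by omega)) hM (sum_eq_zero fun t _ => hne _ _ (by omega))
  · push Not at hscalar
    obtain ⟨v, hv⟩ := hscalar
    obtain ⟨k, rfl⟩ : ∃ k, n = k + 2 := by
      have := hv.fintype_card_le_finrank
      simp only [Fintype.card_fin, Module.finrank_fin_fun] at this
      exact ⟨n - 2, by omega⟩
    obtain ⟨b, hb, hb0, hb1, hbf⟩ := exists_linearIndependent_hessenberg M.toLin' hv k (by simp)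
    set B := basisOfLinearIndependentOfCardEqFinrank hb (by simp) with hB
    have hBb : ⇑B = b := coe_basisOfLinearIndependentOfCardEqFinrank hb _
    obtain ⟨m, hm, hrow, hcol⟩ := hext (LinearMap.toMatrix B B M.toLin')
    have hm_apply : ∀ i j : Fin (k + 2), m i j = B.repr (M.toLin' (B j)) i := by
      intro i j
      rw [← LinearMap.toMatrix_apply, hm, of_apply]
    have hB1 : M.toLin' (B 0) = B 1 := by rw [hBb, hb0, hb1]
    have h0 : m 0 0 = 0 := by
      have := hm_apply 0 0
      rw [hB1] at this
      simpa using this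
    have h1 : m 1 0 ≠ 0 := by
      have := hm_apply 1 0
      rw [hB1] at this
      simp at this
      simp [this]
    have hess : ∀ i j, j + 1 < i → m i j = 0 := by
      intro i j hij
      by_cases hi : i < k + 2
      · have h := hbf ⟨j, by omega⟩ (by simp; omega)
        rw [← hBb, B.mem_span_image] at h
        have h2 := hm_apply ⟨i, hi⟩ ⟨j, by omega⟩
        simp only at h2
        rw [h2]
        by_contra hne
        have h3 := h (Finsupp.mem_support_iff.mpr hne)
        simp only [Set.mem_ofPred_eq] at h3
        omega
      · exact hrow i j (by omega)
    have hdiag : ∑ t ∈ range (k + 2), m t t = 0 := by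
      rw [← htr, ← hm, ← LinearMap.trace_eq_matrix_trace, trace_toLin'_eq, hM]
    obtain ⟨X, Y, hXY⟩ := exists_commutator_of_hessenberg m hrow hcol hess h0 h1 hdiag
    refine ⟨LinearMap.toMatrix' (toLin B B X), LinearMap.toMatrix' (toLin B B Y), ?_⟩
    rw [← LinearMap.toMatrix'_comp, ← LinearMap.toMatrix'_comp, ← toLin_mul, ← toLin_mul,
      ← map_sub, ← map_sub, ← hXY, ← hm, toLin_toMatrix, LinearMap.toMatrix'_toLin']

/-- Every trace zero matrix is a value of any nonzero polynomial `b x y + c y x`. -/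
theorem Matrix.exists_eq_smul_mul_add_smul_mul {K : Type*} [Field K] {n : ℕ}
    (M : Matrix (Fin n) (Fin n) K) (hM : M.trace = 0) {b c : K} (hbc : ¬ (b = 0 ∧ c = 0)) :
    ∃ X Y : Matrix (Fin n) (Fin n) K, M = b • (X * Y) + c • (Y * X) := by
  by_cases h : b + c = 0
  · obtain rfl : c = -b := by linear_combination h
    have hb : b ≠ 0 := by simpa using hbc
    obtain ⟨X, Y, hXY⟩ := M.exists_eq_commutator_of_trace_eq_zero hM
    refine ⟨b⁻¹ • X, Y, ?_⟩
    simp [smul_smul, hb, hXY, sub_eq_add_neg]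
  · refine ⟨(b + c)⁻¹ • M, 1, ?_⟩
    rw [Matrix.mul_one, Matrix.one_mul, ← add_smul, smul_smul, mul_inv_cancel₀ h, one_smul]

theorem image_contains_trace_zero_of_two_var_part_ne_zero (K : Type*) [Field K] (n m : ℕ)
    (hn : 2 ≤ n) (hm : 2 ≤ m) (a : Equiv.Perm (Fin m) → K)
    (hbc : ¬ ((∑ σ : Equiv.Perm (Fin m),
          if σ⁻¹ ⟨0, by omega⟩ < σ⁻¹ ⟨1, by omega⟩ then a σ else 0) = 0 ∧
        (∑ σ : Equiv.Perm (Fin m),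
          if σ⁻¹ ⟨1, by omega⟩ < σ⁻¹ ⟨0, by omega⟩ then a σ else 0) = 0)) :
    {M : Matrix (Fin n) (Fin n) K | Matrix.trace M = 0} ⊆
      {M : Matrix (Fin n) (Fin n) K | ∃ A : Fin m → Matrix (Fin n) (Fin n) K,
        M = ∑ σ : Equiv.Perm (Fin m), a σ • (List.ofFn fun i => A (σ i)).prod} := by
  intro M hM
  obtain ⟨X, Y, hXY⟩ := M.exists_eq_smul_mul_add_smul_mul hM hbc
  refine ⟨fun i => if i = ⟨0, by omega⟩ then X else if i = ⟨1, by omega⟩ then Y else 1, ?_⟩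
  rw [sum_smul_prod_ofFn_eq a (by simp) X Y]
  exact hXY
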